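/- (Strong completeness of ELCR^-) Every ELCR^--consistent set Γ of L^--formulas is satisfiable in a k-sight model, i.e., there exist a k-sight model M and a situation σ such that M,σ ⊨ φ for all φ ∈ Γ. Consequently the static logic is compact: if every finite subset of a set of L^--formulas is satisfiable in a k-sight model, so is the whole set. -/

import Mathlib

/-! Core definitions for the Epistemic Logic of Cops and Robbers (ELCR). -/

/-- The two players/variables. -/
inductive Var : Type
  | x | y
  deriving DecidableEq

/-- The other variable. -/
def Var.other : Var → Var
  | .x => .y
  | .y => .x

/-- Terms: constants or variables. -/
inductive Term (Cons : Type) : Type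
  | const (c : Cons)
  | var (v : Var)
  deriving DecidableEq

/-- Formulas of the full language `L` (with movement modalities). -/
inductive Form (Pred Cons : Type) : Type
  | pred (P : Pred) (args : List (Term Cons))
  | rel (t₁ t₂ : Term Cons)
  | eq (t₁ t₂ : Term Cons)
  | neg (φ : Form Pred Cons)
  | and (φ ψ : Form Pred Cons)
  | Kt (z : Var) (t : Term Cons)
  | K (z : Var) (φ : Form Pred Cons)
  | box (z : Var) (φ : Form Pred Cons)

namespace Form

variable {Pred Cons : Type}

def imp (φ ψ : Form Pred Cons) : Form Pred Cons := .neg (.and φ (.neg ψ))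
def or (φ ψ : Form Pred Cons) : Form Pred Cons := .neg (.and (.neg φ) (.neg ψ))
def iffF (φ ψ : Form Pred Cons) : Form Pred Cons := .and (imp φ ψ) (imp ψ φ)
def falseF : Form Pred Cons := .neg (.eq (.var .x) (.var .x))
def trueF : Form Pred Cons := .neg falseF
/-- `⟨K_z⟩φ := ¬K_z¬φ`. -/
def diaK (z : Var) (φ : Form Pred Cons) : Form Pred Cons := .neg (.K z (.neg φ))

def bigAnd : List (Form Pred Cons) → Form Pred Cons
  | [] => trueF
  | φ :: l => .and φ (bigAnd l)

def bigOr : List (Form Pred Cons) → Form Pred Cons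
  | [] => falseF
  | φ :: l => or φ (bigOr l)

/-- Membership in the Boolean base language `L_B`. -/
def isBase : Form Pred Cons → Prop
  | .pred _ _ => True
  | .rel _ _ => True
  | .eq _ _ => True
  | .neg φ => isBase φ
  | .and φ ψ => isBase φ ∧ isBase ψ
  | .Kt _ _ => False
  | .K _ _ => False
  | .box _ _ => False

/-- Membership in `L_BD` (Booleans plus movement modalities). -/
def isBD : Form Pred Cons → Prop
  | .pred _ _ => True
  | .rel _ _ => True
  | .eq _ _ => True
  | .neg φ => isBD φ
  | .and φ ψ => isBD φ ∧ isBD ψ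
  | .Kt _ _ => False
  | .K _ _ => False
  | .box _ φ => isBD φ

/-- Membership in the full language `L`. -/
def isL : Form Pred Cons → Prop
  | .pred _ _ => True
  | .rel _ _ => True
  | .eq _ _ => True
  | .neg φ => isL φ
  | .and φ ψ => isL φ ∧ isL ψ
  | .Kt _ _ => True
  | .K _ ψ => isBD ψ
  | .box _ φ => isL φ

/-- Membership in the static fragment `L⁻`: no movement modalities, and the
knowledge operator `K_z` is applied to `L_B`-formulas only. -/
def isStatic : Form Pred Cons → Prop
  | .pred _ _ => True
  | .rel _ _ => True
  | .eq _ _ => True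
  | .neg φ => isStatic φ
  | .and φ ψ => isStatic φ ∧ isStatic ψ
  | .Kt _ _ => True
  | .K _ φ => isBase φ
  | .box _ _ => False

/-- The variable `z` occurs in the formula. -/
def occurs (z : Var) : Form Pred Cons → Prop
  | .pred _ args => Term.var z ∈ args
  | .rel t₁ t₂ => t₁ = Term.var z ∨ t₂ = Term.var z
  | .eq t₁ t₂ => t₁ = Term.var z ∨ t₂ = Term.var z
  | .neg φ => occurs z φ
  | .and φ ψ => occurs z φ ∨ occurs z ψ
  | .Kt w t => w = z ∨ t = Term.var z
  | .K w φ => w = z ∨ occurs z φ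
  | .box w φ => w = z ∨ occurs z φ

/-- The list of terms occurring in a formula. -/
def termList : Form Pred Cons → List (Term Cons)
  | .pred _ args => args
  | .rel t₁ t₂ => [t₁, t₂]
  | .eq t₁ t₂ => [t₁, t₂]
  | .neg φ => termList φ
  | .and φ ψ => termList φ ++ termList ψ
  | .Kt _ t => [t]
  | .K _ φ => termList φ
  | .box _ φ => termList φ

end Form

/-- Substituting the constant `c` for the variable `z` in a term. -/
def Term.substC {Cons : Type} (c : Cons) (z : Var) : Term Cons → Term Cons
  | .var v => if v = z then .const c else .var v
  | .const c' => .const c'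

/-- `φ.substC c z` is `φ[c/z]`. -/
def Form.substC {Pred Cons : Type} (c : Cons) (z : Var) : Form Pred Cons → Form Pred Cons
  | .pred P args => .pred P (args.map (Term.substC c z))
  | .rel t₁ t₂ => .rel (t₁.substC c z) (t₂.substC c z)
  | .eq t₁ t₂ => .eq (t₁.substC c z) (t₂.substC c z)
  | .neg φ => .neg (φ.substC c z)
  | .and φ ψ => .and (φ.substC c z) (ψ.substC c z)
  | .Kt w t => .Kt w (t.substC c z)
  | .K w φ => .K w (φ.substC c z)
  | .box w φ => .box w (φ.substC c z)

/-- Replacing the term `t₂` by the term `t₁`. -/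
def Term.repl {Cons : Type} [DecidableEq Cons] (t₁ t₂ t : Term Cons) : Term Cons :=
  if t = t₂ then t₁ else t

/-- `φ.replace t₁ t₂` is `φ[t₁/t₂]`: the result of replacing `t₂` in `φ` with `t₁`. -/
def Form.replace {Pred Cons : Type} [DecidableEq Cons] (t₁ t₂ : Term Cons) :
    Form Pred Cons → Form Pred Cons
  | .pred P args => .pred P (args.map (Term.repl t₁ t₂))
  | .rel s₁ s₂ => .rel (Term.repl t₁ t₂ s₁) (Term.repl t₁ t₂ s₂)
  | .eq s₁ s₂ => .eq (Term.repl t₁ t₂ s₁) (Term.repl t₁ t₂ s₂)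
  | .neg φ => .neg (φ.replace t₁ t₂)
  | .and φ ψ => .and (φ.replace t₁ t₂) (ψ.replace t₁ t₂)
  | .Kt w t => .Kt w (Term.repl t₁ t₂ t)
  | .K w φ => .K w (φ.replace t₁ t₂)
  | .box w φ => .box w (φ.replace t₁ t₂)

/-- The list of all terms (constants and variables), for finite `Cons`. -/
noncomputable def allTerms (Cons : Type) [Fintype Cons] : List (Term Cons) :=
  (Finset.univ : Finset Cons).toList.map Term.const ++ [Term.var .x, Term.var .y]

/-- The syntactic distance formulas `D^n t₁ t₂`. -/
noncomputable def distForm (Pred : Type) {Cons : Type} [Fintype Cons] :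
    ℕ → Term Cons → Term Cons → Form Pred Cons
  | 0, t₁, t₂ => .eq t₁ t₂
  | n + 1, t₁, t₂ =>
      Form.or (distForm Pred n t₁ t₂)
        (Form.bigOr ((allTerms Cons).map fun t =>
          Form.and (distForm Pred n t₁ t) (Form.or (.rel t t₂) (.rel t₂ t))))

/-- `K_z z' = T`: the set `T` consists of the possible positions of `z'` considered by `z`. -/
noncomputable def KzEqSet {Pred Cons : Type} [Fintype Cons] [DecidableEq Cons]
    (z z' : Var) (T : Finset Cons) : Form Pred Cons :=
  Form.bigAnd
    ((T.toList.map fun c => Form.diaK z (.eq (.var z') (.const c))) ++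
      (Tᶜ.toList.map fun c => Form.K z (.neg (.eq (.var z') (.const c)))))

/-- `Rz = T`: `T` is exactly the set of (names of) R-successors of `z`. -/
noncomputable def RzEqSet {Pred Cons : Type} [Fintype Cons] [DecidableEq Cons]
    (z : Var) (T : Finset Cons) : Form Pred Cons :=
  Form.bigAnd
    ((T.toList.map fun c => Form.rel (.var z) (.const c)) ++
      (Tᶜ.toList.map fun c => Form.neg (Form.rel (.var z) (.const c))))

/-- The list of all subsets of `Cons`. -/
noncomputable def powList (Cons : Type) [Fintype Cons] [DecidableEq Cons] : List (Finset Cons) :=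
  (Finset.univ : Finset Cons).powerset.toList

/-! ### Semantics -/

/-- An interpretation of the vocabulary over a domain `D`. -/
structure Interp (Pred Cons D : Type) where
  pred : Pred → List D → Prop
  rel : D → D → Prop
  const : Cons → D

/-- Assignments (situations): positions of the two players. -/
abbrev Assign (D : Type) := Var → D

/-- The value of a term at an interpretation and a situation. -/
def Term.val {Pred Cons D : Type} (I : Interp Pred Cons D) (σ : Assign D) :
    Term Cons → D
  | .const c => I.const c
  | .var v => σ v

/-- `Dball I m s` is `D^m(s)`: points reachable from `s` in at most `m` steps
along `I.rel` or its converse. -/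
def Dball {Pred Cons D : Type} (I : Interp Pred Cons D) : ℕ → D → Set D
  | 0, s => {s}
  | m + 1, s => Dball I m s ∪ {t | ∃ u ∈ Dball I m s, I.rel u t ∨ I.rel t u}

/-- `R^z σ σ'`: player `z` moves along an arrow, the other player stays put. -/
def Rstep {Pred Cons D : Type} (I : Interp Pred Cons D) (z : Var) (σ σ' : Assign D) : Prop :=
  I.rel (σ z) (σ' z) ∧ σ z.other = σ' z.other

/-- Indistinguishability data: a relation on assignments for each player. -/
abbrev SimRel (D : Type) := Var → Assign D → Assign D → Prop

/-- `Σ|σ`: the situations related to `σ` by some player's indistinguishability. -/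
def restrict {D : Type} (Sit : Set (Assign D)) (sim : SimRel D) (σ : Assign D) :
    Set (Assign D) :=
  {σ' ∈ Sit | ∃ z, sim z σ σ'}

/-- The updated set of situations after player `z` moves from `σ₁` to `σ₂`. -/
def updSit {Pred Cons D : Type} (k : ℕ) (I : Interp Pred Cons D)
    (Sit : Set (Assign D)) (sim : SimRel D) (z : Var) (σ₁ σ₂ : Assign D) :
    Set (Assign D) :=
  {σ' | (σ₂ Var.x ∈ Dball I k (σ₂ Var.y) ∧ σ' = σ₂) ∨
        (σ₂ Var.x ∉ Dball I k (σ₂ Var.y) ∧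
          (∃ σ ∈ restrict Sit sim σ₁, Rstep I z σ σ') ∧
          σ' Var.x ∉ Dball I k (σ' Var.y))}

/-- The updated indistinguishability relations: `σ₁ ∼'_z σ₂` iff `σ₁ z = σ₂ z`. -/
def updSim (D : Type) : SimRel D := fun z σ₁ σ₂ => σ₁ z = σ₂ z

/-- Satisfaction for `ELCR` (with sight `k`). -/
def Sat {Pred Cons D : Type} (k : ℕ) (I : Interp Pred Cons D) :
    Set (Assign D) → SimRel D → Assign D → Form Pred Cons → Prop
  | _, _, σ, .pred P args => I.pred P (args.map (Term.val I σ))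
  | _, _, σ, .rel t₁ t₂ => I.rel (t₁.val I σ) (t₂.val I σ)
  | _, _, σ, .eq t₁ t₂ => t₁.val I σ = t₂.val I σ
  | Sit, sim, σ, .neg φ => ¬ Sat k I Sit sim σ φ
  | Sit, sim, σ, .and φ ψ => Sat k I Sit sim σ φ ∧ Sat k I Sit sim σ ψ
  | Sit, sim, σ, .Kt z t => ∀ σ' ∈ Sit, sim z σ' σ → t.val I σ = t.val I σ'
  | Sit, sim, σ, .K z φ => ∀ σ' ∈ Sit, sim z σ' σ → Sat k I Sit sim σ' φ
  | Sit, sim, σ, .box z φ => ∀ σ₂, Rstep I z σ σ₂ →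
      Sat k I (updSit k I Sit sim z σ σ₂) (updSim D) σ₂ φ

/-- The conditions making `(D, I, Σ, ∼)` a model: seriality of `I.rel`, every
point named by a constant, `Σ` nonempty, and each `∼_z` an equivalence relation on `Σ`. -/
structure IsModel {Pred Cons D : Type} (I : Interp Pred Cons D)
    (Sit : Set (Assign D)) (sim : SimRel D) : Prop where
  serial : ∀ s, ∃ t, I.rel s t
  const_surj : Function.Surjective I.const
  nonempty : Sit.Nonempty
  sim_mem : ∀ z σ σ', sim z σ σ' → σ ∈ Sit ∧ σ' ∈ Sit
  sim_refl : ∀ z, ∀ σ ∈ Sit, sim z σ σ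
  sim_symm : ∀ z σ σ', sim z σ σ' → sim z σ' σ
  sim_trans : ∀ z σ₁ σ₂ σ₃, sim z σ₁ σ₂ → sim z σ₂ σ₃ → sim z σ₁ σ₃

/-- The `k`-sight condition. -/
def KSight {Pred Cons D : Type} (k : ℕ) (I : Interp Pred Cons D)
    (Sit : Set (Assign D)) (sim : SimRel D) : Prop :=
  ∀ z σ σ', σ ∈ Sit → σ' ∈ Sit → sim z σ σ' →
    ∀ z', σ z' ∈ Dball I k (σ z) → σ z' = σ' z'

/-- A nonempty conjunction `K_zα₁ ∧ ⋯ ∧ K_zαₙ ∧ ⟨K_z⟩β₁ ∧ ⋯ ∧ ⟨K_z⟩βₘ`. -/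
def kConj {Pred Cons : Type} (z : Var) (αs βs : List (Form Pred Cons)) :
    Form Pred Cons :=
  Form.bigAnd (αs.map (Form.K z) ++ βs.map (Form.diaK z))
/-! ### The proof system ELCR⁻ -/

/-- Evaluation of a formula under a propositional valuation of its non-Boolean
components: used to define propositional tautologies. -/
def Form.evalProp {Pred Cons : Type} (v : Form Pred Cons → Prop) :
    Form Pred Cons → Prop
  | .neg φ => ¬ Form.evalProp v φ
  | .and φ ψ => Form.evalProp v φ ∧ Form.evalProp v ψ
  | φ => v φ

/-- Propositional tautologies. -/
def Form.Tautology {Pred Cons : Type} (φ : Form Pred Cons) : Prop :=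
  ∀ v : Form Pred Cons → Prop, Form.evalProp v φ

/-- The Hilbert-style proof system `ELCR⁻` for the static fragment, with sight `k`. -/
inductive Prov {Pred Cons : Type} [Fintype Cons] [DecidableEq Cons] (k : ℕ) :
    Form Pred Cons → Prop
  | taut {φ : Form Pred Cons} : φ.isStatic → φ.Tautology → Prov k φ
  | mp {φ ψ : Form Pred Cons} : Prov k (φ.imp ψ) → Prov k φ → Prov k ψ
  | eqRefl (t : Term Cons) : Prov k (.eq t t)
  | eqSymm (t₁ t₂ : Term Cons) : Prov k ((Form.eq t₁ t₂).imp (.eq t₂ t₁))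
  | eqTrans (t₁ t₂ t₃ : Term Cons) :
      Prov k (((Form.eq t₁ t₂).and (.eq t₂ t₃)).imp (.eq t₁ t₃))
  | eqSubst {α : Form Pred Cons} (t₁ t₂ : Term Cons) : α.isBase →
      Prov k ((Form.eq t₁ t₂).imp (α.iffF (α.replace t₁ t₂)))
  | seriality (c : Cons) :
      Prov k (Form.bigOr ((Finset.univ : Finset Cons).toList.map fun t =>
        Form.rel (.const c) (.const t)))
  | atSomewhere (z : Var) :
      Prov k (Form.bigOr ((Finset.univ : Finset Cons).toList.map fun c =>
        Form.eq (.var z) (.const c)))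
  | ksight (z : Var) (t : Term Cons) :
      Prov k ((distForm Pred k (.var z) t).imp (.Kt z t))
  | kAx {α β : Form Pred Cons} (z : Var) : α.isBase → β.isBase →
      Prov k ((Form.K z (α.imp β)).imp ((Form.K z α).imp (.K z β)))
  | tAx {α : Form Pred Cons} (z : Var) : α.isBase →
      Prov k ((Form.K z α).imp α)
  | kGround {α : Form Pred Cons} (z : Var) (T : Finset Cons) : α.isBase →
      Prov k ((KzEqSet z z.other T).imp
        ((Form.K z α).iffF (Form.bigAnd (T.toList.map fun c => α.substC c z.other))))
  | kAdd {α : Form Pred Cons} (z : Var) (αs βs : List (Form Pred Cons)) :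
      α.isBase → (∀ γ ∈ αs, γ.isBase) → (∀ γ ∈ βs, γ.isBase) →
      1 ≤ αs.length + βs.length →
      Prov k ((kConj z αs βs).imp α) → Prov k ((kConj z αs βs).imp (.K z α))
  | kElim {α β : Form Pred Cons} (z : Var) (αs βs : List (Form Pred Cons)) :
      α.isBase → β.isBase → (∀ γ ∈ αs, γ.isBase) → (∀ γ ∈ βs, γ.isBase) →
      1 ≤ αs.length + βs.length →
      Prov k ((kConj z.other αs βs).imp ((Form.K z α).imp β)) →
      Prov k ((kConj z.other αs βs).imp (α.imp β))
  | deRe (z : Var) (t : Term Cons) (c : Cons) :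
      Prov k ((Form.eq t (.const c)).imp
        ((Form.Kt z t).iffF (.K z (.eq t (.const c)))))
  | structK {α : Form Pred Cons} (z : Var) (T : Finset (Term Cons)) : α.isBase →
      (∀ t ∈ α.termList, t ∈ T) →
      Prov k (((Form.bigAnd (T.toList.map (Form.Kt z))).and α).imp (.K z α))

/-- A set of formulas is consistent if no finite conjunction from it proves `⊥`. -/
def consistentS {Pred Cons : Type} [Fintype Cons] [DecidableEq Cons] (k : ℕ)
    (Γ : Set (Form Pred Cons)) : Prop :=
  ¬ ∃ l : List (Form Pred Cons), (∀ φ ∈ l, φ ∈ Γ) ∧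
      Prov k ((Form.bigAnd l).imp Form.falseF)

/-- Maximally consistent sets of `L⁻`-formulas. -/
def MCS {Pred Cons : Type} [Fintype Cons] [DecidableEq Cons] (k : ℕ)
    (Δ : Set (Form Pred Cons)) : Prop :=
  consistentS k Δ ∧ (∀ φ ∈ Δ, Form.isStatic φ) ∧
    ∀ φ : Form Pred Cons, φ.isStatic → φ ∈ Δ ∨ Form.neg φ ∈ Δ

/-- All terms of the formula are constants. -/
def isConsOnly {Pred Cons : Type} (φ : Form Pred Cons) : Prop :=
  ∀ t ∈ φ.termList, ∃ c : Cons, t = Term.const c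

/-- `Δ₁ =^Cons Δ₂`: the two sets contain the same `L_B`-formulas whose terms are
all constants. -/
def consEq {Pred Cons : Type} (Δ₁ Δ₂ : Set (Form Pred Cons)) : Prop :=
  ∀ α : Form Pred Cons, α.isBase → isConsOnly α → (α ∈ Δ₁ ↔ α ∈ Δ₂)

section Completeness

variable {Pred Cons : Type}

namespace Form

/-! ### Syntactic closure and propositional evaluation -/

theorem isBase.isStatic {φ : Form Pred Cons} (h : φ.isBase) : φ.isStatic := by
  induction φ with
  | neg φ ih => exact ih h
  | and φ ψ ih₁ ih₂ => exact ⟨ih₁ h.1, ih₂ h.2⟩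
  | K | Kt | box => exact h.elim
  | _ => trivial

theorem isStatic_imp {φ ψ : Form Pred Cons} :
    (φ.imp ψ).isStatic ↔ φ.isStatic ∧ ψ.isStatic := Iff.rfl

theorem isBase_eq (t₁ t₂ : Term Cons) : (eq t₁ t₂ : Form Pred Cons).isBase := trivial

theorem isStatic_eq (t₁ t₂ : Term Cons) : (eq t₁ t₂ : Form Pred Cons).isStatic := trivial

theorem isStatic_Kt (z : Var) (t : Term Cons) : (Kt z t : Form Pred Cons).isStatic := trivial

theorem isStatic_K {z : Var} {φ : Form Pred Cons} : (K z φ).isStatic ↔ φ.isBase := Iff.rfl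

theorem isStatic_bigAnd {l : List (Form Pred Cons)} :
    (bigAnd l).isStatic ↔ ∀ φ ∈ l, φ.isStatic := by
  induction l with
  | nil => simp [bigAnd, trueF, falseF, isStatic]
  | cons φ l ih => simp [bigAnd, isStatic, ih]

theorem isStatic_bigOr {l : List (Form Pred Cons)} :
    (bigOr l).isStatic ↔ ∀ φ ∈ l, φ.isStatic := by
  induction l with
  | nil => simp [bigOr, falseF, isStatic]
  | cons φ l ih => simp [bigOr, or, isStatic, ih]

theorem isBase_bigOr {l : List (Form Pred Cons)} :
    (bigOr l).isBase ↔ ∀ φ ∈ l, φ.isBase := by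
  induction l with
  | nil => simp [bigOr, falseF, isBase]
  | cons φ l ih => simp [bigOr, or, isBase, ih]

theorem isBase_substC {φ : Form Pred Cons} (c : Cons) (z : Var) (h : φ.isBase) :
    (φ.substC c z).isBase := by
  induction φ with
  | neg φ ih => exact ih h
  | and φ ψ ih₁ ih₂ => exact ⟨ih₁ h.1, ih₂ h.2⟩
  | K | Kt | box => exact h.elim
  | _ => trivial

theorem isBase_replace [DecidableEq Cons] {φ : Form Pred Cons} (t₁ t₂ : Term Cons)
    (h : φ.isBase) : (φ.replace t₁ t₂).isBase := by
  induction φ with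
  | neg φ ih => exact ih h
  | and φ ψ ih₁ ih₂ => exact ⟨ih₁ h.1, ih₂ h.2⟩
  | K | Kt | box => exact h.elim
  | _ => trivial

theorem isBase_distForm [Fintype Cons] (n : ℕ) (t₁ t₂ : Term Cons) :
    (distForm Pred n t₁ t₂).isBase := by
  induction n generalizing t₂ with
  | zero => trivial
  | succ n ih =>
    refine ⟨ih t₂, isBase_bigOr.2 fun φ hφ => ?_⟩
    obtain ⟨t, -, rfl⟩ := List.mem_map.1 hφ
    exact ⟨ih t, trivial, trivial⟩

theorem isStatic_kConj {z : Var} {αs βs : List (Form Pred Cons)}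
    (hα : ∀ γ ∈ αs, γ.isBase) (hβ : ∀ γ ∈ βs, γ.isBase) : (kConj z αs βs).isStatic := by
  refine isStatic_bigAnd.2 fun φ hφ => ?_
  rcases List.mem_append.1 hφ with h | h <;> obtain ⟨γ, hγ, rfl⟩ := List.mem_map.1 h
  exacts [hα γ hγ, hβ γ hγ]

@[simp] theorem evalProp_neg (v : Form Pred Cons → Prop) (φ : Form Pred Cons) :
    evalProp v (.neg φ) ↔ ¬ evalProp v φ := Iff.rfl

@[simp] theorem evalProp_and (v : Form Pred Cons → Prop) (φ ψ : Form Pred Cons) :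
    evalProp v (.and φ ψ) ↔ evalProp v φ ∧ evalProp v ψ := Iff.rfl

@[simp] theorem evalProp_imp (v : Form Pred Cons → Prop) (φ ψ : Form Pred Cons) :
    evalProp v (φ.imp ψ) ↔ (evalProp v φ → evalProp v ψ) := by
  simp [imp]

@[simp] theorem evalProp_falseF (v : Form Pred Cons → Prop) :
    evalProp v falseF ↔ ¬ v (.eq (.var .x) (.var .x)) := Iff.rfl

theorem evalProp_bigAnd {v : Form Pred Cons → Prop} (hv : v (.eq (.var .x) (.var .x)))
    (l : List (Form Pred Cons)) : evalProp v (bigAnd l) ↔ ∀ φ ∈ l, evalProp v φ := by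
  induction l with
  | nil => simpa [bigAnd, trueF] using hv
  | cons φ l ih => simp [bigAnd, ih]

end Form

/-! ### Satisfaction -/

section Sat

variable {D : Type} {k : ℕ} {I : Interp Pred Cons D} {Sit : Set (Assign D)} {sim : SimRel D}
  {σ : Assign D}

@[simp] theorem sat_neg {φ : Form Pred Cons} :
    Sat k I Sit sim σ (.neg φ) ↔ ¬ Sat k I Sit sim σ φ := by
  simp only [Sat]

@[simp] theorem sat_and {φ ψ : Form Pred Cons} :
    Sat k I Sit sim σ (.and φ ψ) ↔ Sat k I Sit sim σ φ ∧ Sat k I Sit sim σ ψ := by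
  simp only [Sat]

@[simp] theorem sat_eq {t₁ t₂ : Term Cons} :
    Sat k I Sit sim σ (.eq t₁ t₂) ↔ t₁.val I σ = t₂.val I σ := by
  simp only [Sat]

@[simp] theorem sat_rel {t₁ t₂ : Term Cons} :
    Sat k I Sit sim σ (.rel t₁ t₂) ↔ I.rel (t₁.val I σ) (t₂.val I σ) := by
  simp only [Sat]

theorem sat_K {z : Var} {φ : Form Pred Cons} :
    Sat k I Sit sim σ (.K z φ) ↔ ∀ σ' ∈ Sit, sim z σ' σ → Sat k I Sit sim σ' φ := by
  simp only [Sat]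

theorem sat_Kt {z : Var} {t : Term Cons} :
    Sat k I Sit sim σ (.Kt z t) ↔ ∀ σ' ∈ Sit, sim z σ' σ → t.val I σ = t.val I σ' := by
  simp only [Sat]

@[simp] theorem sat_imp {φ ψ : Form Pred Cons} :
    Sat k I Sit sim σ (φ.imp ψ) ↔ (Sat k I Sit sim σ φ → Sat k I Sit sim σ ψ) := by
  simp [Form.imp]

@[simp] theorem sat_or {φ ψ : Form Pred Cons} :
    Sat k I Sit sim σ (φ.or ψ) ↔ Sat k I Sit sim σ φ ∨ Sat k I Sit sim σ ψ := by
  simp only [Form.or, sat_neg, sat_and]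
  tauto

@[simp] theorem sat_iffF {φ ψ : Form Pred Cons} :
    Sat k I Sit sim σ (φ.iffF ψ) ↔ (Sat k I Sit sim σ φ ↔ Sat k I Sit sim σ ψ) := by
  simp [Form.iffF, iff_def]

@[simp] theorem sat_falseF : ¬ Sat k I Sit sim σ Form.falseF := by
  simp [Form.falseF]

@[simp] theorem sat_bigAnd {l : List (Form Pred Cons)} :
    Sat k I Sit sim σ (Form.bigAnd l) ↔ ∀ φ ∈ l, Sat k I Sit sim σ φ := by
  induction l with
  | nil => simp [Form.bigAnd, Form.trueF]
  | cons φ l ih => simp [Form.bigAnd, ih]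

@[simp] theorem sat_bigOr {l : List (Form Pred Cons)} :
    Sat k I Sit sim σ (Form.bigOr l) ↔ ∃ φ ∈ l, Sat k I Sit sim σ φ := by
  induction l with
  | nil => simp [Form.bigOr]
  | cons φ l ih => simp [Form.bigOr, ih]

theorem sat_evalProp {φ : Form Pred Cons} :
    Form.evalProp (Sat k I Sit sim σ) φ ↔ Sat k I Sit sim σ φ := by
  induction φ with
  | neg φ ih => simp [ih]
  | and φ ψ ih₁ ih₂ => simp [ih₁, ih₂]
  | _ => exact Iff.rfl

/-- The truth of a base formula only depends on the values of its terms. -/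
theorem sat_congr_of_isBase {α : Form Pred Cons} (hα : α.isBase) {Sit' : Set (Assign D)}
    {sim' : SimRel D} {σ' : Assign D} (h : ∀ t ∈ α.termList, t.val I σ = t.val I σ') :
    Sat k I Sit sim σ α ↔ Sat k I Sit' sim' σ' α := by
  induction α with
  | pred P args =>
    have : args.map (Term.val I σ) = args.map (Term.val I σ') := List.map_congr_left h
    simp only [Sat, this]
  | rel t₁ t₂ | eq t₁ t₂ =>
    simp only [Form.termList, List.mem_cons, List.not_mem_nil, or_false, forall_eq_or_imp,
      forall_eq] at h
    simp [h.1, h.2]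
  | neg φ ih => simp only [sat_neg, ih hα h]
  | and φ ψ ih₁ ih₂ =>
    simp only [Form.termList, List.mem_append] at h
    simp only [sat_and, ih₁ hα.1 fun t ht => h t (.inl ht), ih₂ hα.2 fun t ht => h t (.inr ht)]
  | K | Kt | box => exact hα.elim

theorem sat_iff_of_isBase {α : Form Pred Cons} (hα : α.isBase) (Sit' : Set (Assign D))
    (sim' : SimRel D) : Sat k I Sit sim σ α ↔ Sat k I Sit' sim' σ α :=
  sat_congr_of_isBase hα fun _ _ => rfl

theorem val_substC (c : Cons) (z : Var) (t : Term Cons) :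
    (t.substC c z).val I σ = t.val I (Function.update σ z (I.const c)) := by
  cases t with
  | const c' => rfl
  | var v =>
    by_cases h : v = z
    · subst h; simp [Term.substC, Term.val]
    · simp [Term.substC, Term.val, h]

theorem sat_substC {α : Form Pred Cons} (hα : α.isBase) (c : Cons) (z : Var) :
    Sat k I Sit sim σ (α.substC c z) ↔
      Sat k I Sit sim (Function.update σ z (I.const c)) α := by
  induction α with
  | pred P args =>
    have : Term.val I σ ∘ Term.substC c z = Term.val I (Function.update σ z (I.const c)) :=
      funext (val_substC c z)
    simp only [Form.substC, Sat, List.map_map, this]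
  | rel t₁ t₂ | eq t₁ t₂ => simp [Form.substC, val_substC]
  | neg φ ih => simp only [Form.substC, sat_neg, ih hα]
  | and φ ψ ih₁ ih₂ => simp only [Form.substC, sat_and, ih₁ hα.1, ih₂ hα.2]
  | K | Kt | box => exact hα.elim

theorem val_repl [DecidableEq Cons] {t₁ t₂ : Term Cons} (h : t₁.val I σ = t₂.val I σ)
    (t : Term Cons) : (Term.repl t₁ t₂ t).val I σ = t.val I σ := by
  unfold Term.repl
  split_ifs with ht
  · rw [h, ht]
  · rfl

theorem foldr_repl [DecidableEq Cons] {f : Term Cons → Term Cons} (hf : ∀ t, f (f t) = f t)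
    (S : List (Term Cons))
    (t : Term Cons) :
    (S.foldr (fun s u => Term.repl (f s) s u) t) = if t ∈ S then f t else t := by
  induction S with
  | nil => simp
  | cons s S ih =>
    rw [List.foldr_cons, ih]
    unfold Term.repl
    by_cases hts : t = s
    · subst hts
      by_cases ht : t ∈ S
      · by_cases h' : f t = t <;> simp [ht, h']
      · simp [ht]
    · by_cases ht : t ∈ S
      · by_cases h' : f t = s
        · subst h'; simp [ht, hf]
        · simp [ht, h']
      · simp [ht, hts]

theorem sat_replace [DecidableEq Cons] {α : Form Pred Cons} (hα : α.isBase)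
    {t₁ t₂ : Term Cons} (h : t₁.val I σ = t₂.val I σ) :
    Sat k I Sit sim σ (α.replace t₁ t₂) ↔ Sat k I Sit sim σ α := by
  induction α with
  | pred P args =>
    have : Term.val I σ ∘ Term.repl t₁ t₂ = Term.val I σ := funext (val_repl h)
    simp only [Form.replace, Sat, List.map_map, this]
  | rel | eq => simp [Form.replace, val_repl h]
  | neg φ ih => simp only [Form.replace, sat_neg, ih hα]
  | and φ ψ ih₁ ih₂ => simp only [Form.replace, sat_and, ih₁ hα.1, ih₂ hα.2]
  | K | Kt | box => exact hα.elim

theorem sat_distForm [Fintype Cons] (hI : Function.Surjective I.const) (n : ℕ)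
    (t₁ t₂ : Term Cons) :
    Sat k I Sit sim σ (distForm Pred n t₁ t₂) ↔ t₂.val I σ ∈ Dball I n (t₁.val I σ) := by
  induction n generalizing t₂ with
  | zero => simp [distForm, Dball, eq_comm]
  | succ n ih =>
    simp only [distForm, Dball, sat_or, sat_bigOr, List.mem_map, exists_exists_and_eq_and, sat_and,
      sat_rel, ih, Set.mem_union, Set.mem_ofPred_eq]
    refine or_congr_right ⟨fun ⟨t, _, h⟩ => ⟨_, h⟩, fun ⟨u, h⟩ => ?_⟩
    obtain ⟨c, rfl⟩ := hI u
    exact ⟨.const c, by simp [allTerms], h⟩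

theorem self_mem_Dball (n : ℕ) (s : D) : s ∈ Dball I n s := by
  induction n with
  | zero => rfl
  | succ n ih => exact .inl ih

theorem Var.eq_or_eq_other (z w : Var) : w = z ∨ w = z.other := by
  cases z <;> cases w <;> simp [Var.other]

theorem Var.ne_other (z : Var) : z ≠ z.other := by
  cases z <;> simp [Var.other]

theorem sat_KzEqSet [Fintype Cons] [DecidableEq Cons] {z z' : Var} {T : Finset Cons} :
    Sat k I Sit sim σ (KzEqSet z z' T) ↔
      ∀ c, c ∈ T ↔ ∃ σ' ∈ Sit, sim z σ' σ ∧ σ' z' = I.const c := by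
  simp only [KzEqSet, sat_bigAnd, List.forall_mem_append, List.forall_mem_map, Finset.mem_toList,
    Finset.mem_compl, Form.diaK, sat_neg, sat_K, sat_eq, Term.val]
  push Not
  exact ⟨fun h c => ⟨h.1 c, fun ⟨σ', h₁, h₂, h₃⟩ => by_contra fun hc => h.2 c hc σ' h₁ h₂ h₃⟩,
    fun h => ⟨fun c => (h c).1, fun c hc σ' h₁ h₂ h₃ => hc ((h c).2 ⟨σ', h₁, h₂, h₃⟩)⟩⟩

theorem sat_kConj_iff {D : Type} {I : Interp Pred Cons D} {Sit : Set (Assign D)}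
    {sim sim' : SimRel D} {σ σ' : Assign D} {z : Var} {αs βs : List (Form Pred Cons)}
    (hα : ∀ γ ∈ αs, γ.isBase) (hβ : ∀ γ ∈ βs, γ.isBase)
    (h : ∀ τ, sim z τ σ ↔ sim' z τ σ') :
    Sat k I Sit sim σ (kConj z αs βs) ↔ Sat k I Sit sim' σ' (kConj z αs βs) := by
  have key : ∀ γ : Form Pred Cons, γ.isBase →
      (Sat k I Sit sim σ (.K z γ) ↔ Sat k I Sit sim' σ' (.K z γ)) := fun γ hγ => by
    simp only [sat_K, h, sat_iff_of_isBase (sim := sim) hγ Sit sim']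
  simp only [kConj, sat_bigAnd, List.forall_mem_append, List.forall_mem_map, Form.diaK, sat_neg]
  refine and_congr (forall₂_congr fun γ hγ => key γ (hα γ hγ))
    (forall₂_congr fun γ hγ => not_congr (key γ.neg (hβ γ hγ)))

end Sat

section Calculus

variable [Fintype Cons] [DecidableEq Cons] {k : ℕ}

/-! ### Soundness -/

theorem Prov.sound {φ : Form Pred Cons} (h : Prov k φ) {D : Type} {I : Interp Pred Cons D}
    {Sit : Set (Assign D)} {sim : SimRel D} (hM : IsModel I Sit sim) (hk : KSight k I Sit sim)
    {σ : Assign D} (hσ : σ ∈ Sit) : Sat k I Sit sim σ φ := by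
  induction h generalizing sim σ with
  | taut _ h => exact sat_evalProp.1 (h _)
  | mp _ _ ih₁ ih₂ => exact sat_imp.1 (ih₁ hM hk hσ) (ih₂ hM hk hσ)
  | eqRefl t => simp
  | eqSymm t₁ t₂ => simpa using Eq.symm
  | eqTrans t₁ t₂ t₃ => simpa using Eq.trans
  | eqSubst t₁ t₂ hα => simpa using fun h => (sat_replace hα h).symm
  | seriality c =>
    obtain ⟨s, hs⟩ := hM.serial (I.const c)
    obtain ⟨d, rfl⟩ := hM.const_surj s
    simpa [Term.val] using ⟨d, hs⟩
  | atSomewhere z =>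
    obtain ⟨c, hc⟩ := hM.const_surj (σ z)
    simpa [Term.val] using ⟨c, hc.symm⟩
  | ksight z t =>
    rw [sat_imp, sat_distForm hM.const_surj, sat_Kt]
    intro h σ' hσ' hs
    cases t with
    | const c => rfl
    | var w => exact hk z σ σ' hσ hσ' (hM.sim_symm _ _ _ hs) w h
  | kAx z _ _ =>
    simp only [sat_imp, sat_K]
    exact fun h₁ h₂ σ' hσ' hs => h₁ σ' hσ' hs (h₂ σ' hσ' hs)
  | tAx z _ =>
    simp only [sat_imp, sat_K]
    exact fun h => h σ hσ (hM.sim_refl z σ hσ)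
  | kGround z T hα =>
    rw [sat_imp, sat_iffF, sat_KzEqSet, sat_bigAnd, sat_K, List.forall_mem_map]
    intro hT
    have upd : ∀ σ' ∈ Sit, sim z σ' σ → ∀ c, σ' z.other = I.const c →
        Function.update σ z.other (I.const c) = σ' := fun σ' hσ' hs c hc => by
      funext w
      rcases z.eq_or_eq_other w with rfl | rfl
      · rw [Function.update_of_ne w.ne_other]
        exact hk w σ σ' hσ hσ' (hM.sim_symm _ _ _ hs) w (self_mem_Dball k _)
      · rw [Function.update_self, hc]
    constructor
    · intro h c hc
      obtain ⟨σ', hσ', hs, hc'⟩ := (hT c).1 (Finset.mem_toList.1 hc)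
      rw [sat_substC hα, upd σ' hσ' hs c hc']
      exact h σ' hσ' hs
    · intro h σ' hσ' hs
      obtain ⟨c, hc⟩ := hM.const_surj (σ' z.other)
      rw [← upd σ' hσ' hs c hc.symm, ← sat_substC hα]
      exact h c (Finset.mem_toList.2 ((hT c).2 ⟨σ', hσ', hs, hc.symm⟩))
  | kAdd z αs βs _ hαs hβs _ _ ih =>
    rw [sat_imp, sat_K]
    intro h σ' hσ' hs
    refine sat_imp.1 (ih hM hk hσ') ((sat_kConj_iff hαs hβs fun τ => ?_).1 h)
    exact ⟨fun h => hM.sim_trans _ _ _ _ h (hM.sim_symm _ _ _ hs),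
      fun h => hM.sim_trans _ _ _ _ h hs⟩
  | @kElim α β z αs βs hα hβ hαs hβs _ _ ih =>
    -- Give player `z` perfect information: then `K_z α` and `α` are equivalent.
    let sim' : SimRel D := fun w τ τ' => if w = z then τ = τ' ∧ τ ∈ Sit else sim w τ τ'
    have hM' : IsModel I Sit sim' := by
      refine ⟨hM.serial, hM.const_surj, hM.nonempty, ?_, ?_, ?_, ?_⟩ <;> intro w <;>
        by_cases hw : w = z <;> simp only [sim', hw, if_true, if_false]
      · rintro τ τ' ⟨rfl, h⟩
        exact ⟨h, h⟩
      · exact hM.sim_mem w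
      · exact fun τ h => ⟨trivial, h⟩
      · exact hM.sim_refl w
      · rintro τ τ' ⟨rfl, h⟩
        exact ⟨rfl, h⟩
      · exact hM.sim_symm w
      · rintro τ τ' τ'' ⟨rfl, h⟩ h'
        exact h'
      · exact hM.sim_trans w
    have hk' : KSight k I Sit sim' := by
      intro w τ τ' hτ hτ' hs w' hw'
      by_cases hw : w = z
      · simp only [sim', hw, if_true] at hs
        rw [hs.1]
      · simp only [sim', hw, if_false] at hs
        exact hk w τ τ' hτ hτ' hs w' hw'
    have h := ih hM' hk' hσ
    simp only [sat_imp] at h ⊢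
    intro h₁ h₂
    refine (sat_iff_of_isBase hβ Sit sim').2 (h ?_ (sat_K.2 fun σ' _ hs => ?_))
    · exact (sat_kConj_iff hαs hβs fun τ => by simp [sim', z.ne_other.symm]).1 h₁
    · simp only [sim', if_true] at hs
      rw [hs.1]
      exact (sat_iff_of_isBase hα Sit sim').1 h₂
  | deRe z t c =>
    rw [sat_imp, sat_iffF, sat_eq, sat_Kt, sat_K]
    intro h
    simp only [sat_eq, h]
    exact forall₃_congr fun _ _ _ => eq_comm
  | structK z T hα hT =>
    rw [sat_imp, sat_and, sat_bigAnd, sat_K]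
    rintro ⟨h₁, h₂⟩ σ' hσ' hs
    refine (sat_congr_of_isBase hα fun t ht => ?_).1 h₂
    exact sat_Kt.1 (h₁ _ (List.mem_map_of_mem (Finset.mem_toList.2 (hT t ht)))) σ' hσ' hs

/-! ### Maximally consistent sets -/

/-- Provability is closed under propositional consequence. -/
theorem Prov.of_evalProp (L : List (Form Pred Cons)) {φ : Form Pred Cons}
    (hL : ∀ ψ ∈ L, Prov k ψ ∧ ψ.isStatic) (hφ : φ.isStatic)
    (h : ∀ v : Form Pred Cons → Prop, v (.eq (.var .x) (.var .x)) →
      (∀ ψ ∈ L, ψ.evalProp v) → φ.evalProp v) : Prov k φ := by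
  induction L generalizing φ with
  | nil =>
    refine .mp (.taut (Form.isStatic_imp.2 ⟨Form.isStatic_eq _ _, hφ⟩) fun v => ?_)
      (.eqRefl (.var .x))
    rw [Form.evalProp_imp]
    exact fun hv => h v hv (by simp)
  | cons ψ L ih =>
    rw [List.forall_mem_cons] at hL
    refine .mp (ih (φ := ψ.imp φ) hL.2 ⟨hL.1.2, hφ⟩ fun v hv hvL => ?_) hL.1.1
    rw [Form.evalProp_imp]
    exact fun hψ => h v hv (List.forall_mem_cons.2 ⟨hψ, hvL⟩)

namespace consistentS

theorem exists_MCS {Γ : Set (Form Pred Cons)} (hΓ : ∀ φ ∈ Γ, φ.isStatic)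
    (hc : consistentS k Γ) : ∃ Δ, Γ ⊆ Δ ∧ MCS k Δ := by
  obtain ⟨Δ, hΓΔ, hΔ⟩ := zorn_subset_nonempty
    {Δ : Set (Form Pred Cons) | consistentS k Δ ∧ ∀ φ ∈ Δ, φ.isStatic} (by
      refine fun C hC hchain hne => ⟨⋃₀ C, ⟨?_, ?_⟩, fun s hs => Set.subset_sUnion_of_mem hs⟩
      · rintro ⟨l, hl, hp⟩
        have : ∃ s ∈ C, ∀ φ ∈ l, φ ∈ s := by
          clear hp
          induction l with
          | nil => exact ⟨hne.some, hne.some_mem, by simp⟩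
          | cons φ l ih =>
            rw [List.forall_mem_cons] at hl
            obtain ⟨s, hs, hls⟩ := ih hl.2
            obtain ⟨t, ht, hφt⟩ := hl.1
            rcases hchain.total hs ht with h | h
            · exact ⟨t, ht, List.forall_mem_cons.2 ⟨hφt, fun ψ hψ => h (hls ψ hψ)⟩⟩
            · exact ⟨s, hs, List.forall_mem_cons.2 ⟨h hφt, hls⟩⟩
        obtain ⟨s, hs, hls⟩ := this
        exact (hC hs).1 ⟨l, hls, hp⟩
      · rintro φ ⟨s, hs, hφ⟩
        exact (hC hs).2 φ hφ) Γ ⟨hc, hΓ⟩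
  refine ⟨Δ, hΓΔ, hΔ.prop.1, hΔ.prop.2, fun φ hφ => ?_⟩
  have extend : ∀ ψ : Form Pred Cons, ψ.isStatic → ψ ∉ Δ →
      ∃ l, (∀ χ ∈ l, χ ∈ Δ) ∧ Prov k ((Form.bigAnd l).imp ψ.neg) := by
    intro ψ hψ hψΔ
    have hst : ∀ χ ∈ insert ψ Δ, χ.isStatic := by
      rintro χ (rfl | h)
      exacts [hψ, hΔ.prop.2 χ h]
    have hinc : ¬ consistentS k (insert ψ Δ) := fun hcons =>
      hψΔ (hΔ.le_of_ge ⟨hcons, hst⟩ (Set.subset_insert ψ Δ) (Set.mem_insert ψ Δ))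
    obtain ⟨l, hl, hp⟩ := not_not.1 hinc
    classical
    have hl' : ∀ χ ∈ l.filter (· ≠ ψ), χ ∈ Δ := fun χ hχ => by
      simp only [List.mem_filter, decide_eq_true_eq] at hχ
      exact (hl χ hχ.1).resolve_left hχ.2
    refine ⟨_, hl', .of_evalProp [_] (by
      simpa using ⟨hp, Form.isStatic_imp.2
        ⟨Form.isStatic_bigAnd.2 fun χ hχ => hst χ (hl χ hχ), trivial⟩⟩)
      ⟨Form.isStatic_bigAnd.2 fun χ hχ => hΔ.prop.2 χ (hl' χ hχ), hψ⟩ fun v hv h => ?_⟩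
    simp only [List.mem_singleton, forall_eq, Form.evalProp_imp, Form.evalProp_bigAnd hv,
      Form.evalProp_falseF, Form.evalProp_neg, hv, not_true_eq_false, imp_false,
      List.mem_filter, decide_eq_true_eq] at h ⊢
    refine fun h₁ h₂ => h fun χ hχ => ?_
    by_cases hχψ : χ = ψ
    · exact hχψ ▸ h₂
    · exact h₁ χ ⟨hχ, hχψ⟩
  by_contra! hn
  obtain ⟨l₁, h₁, hp₁⟩ := extend φ hφ hn.1
  obtain ⟨l₂, h₂, hp₂⟩ := extend φ.neg hφ hn.2
  have hs : ∀ l : List (Form Pred Cons), (∀ χ ∈ l, χ ∈ Δ) → (Form.bigAnd l).isStatic :=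
    fun l h => Form.isStatic_bigAnd.2 fun χ hχ => hΔ.prop.2 χ (h χ hχ)
  have h₁₂ := List.forall_mem_append.2 ⟨h₁, h₂⟩
  refine hΔ.prop.1 ⟨l₁ ++ l₂, h₁₂, .of_evalProp [_, _] (List.forall_mem_cons.2
    ⟨⟨hp₁, hs _ h₁, hφ⟩, List.forall_mem_singleton.2 ⟨hp₂, hs _ h₂, hφ⟩⟩)
    ⟨hs _ h₁₂, trivial⟩ fun v hv h => ?_⟩
  simp only [List.mem_cons, List.not_mem_nil, or_false, forall_eq_or_imp, forall_eq,
    Form.evalProp_imp, Form.evalProp_bigAnd hv, Form.evalProp_neg, List.forall_mem_append] at h ⊢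
  exact fun h' => absurd (h.1 h'.1) (h.2 h'.2)

end consistentS

namespace MCS

variable {Δ : Set (Form Pred Cons)}

theorem mem_of_prov_bigAnd (h : MCS k Δ) {l : List (Form Pred Cons)} (hl : ∀ ψ ∈ l, ψ ∈ Δ)
    {φ : Form Pred Cons} (hφ : φ.isStatic) (hp : Prov k ((Form.bigAnd l).imp φ)) : φ ∈ Δ := by
  refine (h.2.2 φ hφ).resolve_right fun hn => h.1 ⟨φ.neg :: l, List.forall_mem_cons.2 ⟨hn, hl⟩, ?_⟩
  have hs : (Form.bigAnd l).isStatic := Form.isStatic_bigAnd.2 fun ψ hψ => h.2.1 ψ (hl ψ hψ)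
  refine .of_evalProp [_] (List.forall_mem_singleton.2 ⟨hp, hs, hφ⟩) ⟨⟨hφ, hs⟩, trivial⟩
    fun v hv h => ?_
  simp only [List.mem_singleton, forall_eq, Form.evalProp_imp, Form.bigAnd, Form.evalProp_and,
    Form.evalProp_neg] at h ⊢
  exact fun h' => absurd (h h'.2) h'.1

theorem mem_of_evalProp (h : MCS k Δ) (l : List (Form Pred Cons)) (hl : ∀ ψ ∈ l, ψ ∈ Δ)
    {φ : Form Pred Cons} (hφ : φ.isStatic)
    (hv : ∀ v : Form Pred Cons → Prop, (∀ ψ ∈ l, ψ.evalProp v) → φ.evalProp v) : φ ∈ Δ := by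
  refine h.mem_of_prov_bigAnd hl hφ (.of_evalProp [] (by simp)
    ⟨Form.isStatic_bigAnd.2 fun ψ hψ => h.2.1 ψ (hl ψ hψ), hφ⟩ fun v hx _ => ?_)
  rw [Form.evalProp_imp, Form.evalProp_bigAnd hx]
  exact hv v

theorem mem_of_prov (h : MCS k Δ) {φ : Form Pred Cons} (hφ : φ.isStatic) (hp : Prov k φ) :
    φ ∈ Δ :=
  h.mem_of_prov_bigAnd (l := []) (by simp) hφ <|
    .of_evalProp [_] (List.forall_mem_singleton.2 ⟨hp, hφ⟩) ⟨trivial, hφ⟩ fun v _ h => by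
      simpa using fun _ => h φ

theorem neg_mem (h : MCS k Δ) {φ : Form Pred Cons} (hφ : φ.isStatic) :
    φ.neg ∈ Δ ↔ φ ∉ Δ := by
  refine ⟨fun h₁ h₂ => ?_, (h.2.2 φ hφ).resolve_left⟩
  have hs : (Form.falseF : Form Pred Cons) ∈ Δ :=
    h.mem_of_evalProp [φ, φ.neg] (by simp [h₁, h₂]) trivial fun v hv => by
      simp only [List.mem_cons, List.not_mem_nil, or_false, forall_eq_or_imp, forall_eq,
        Form.evalProp_neg] at hv
      exact absurd hv.1 hv.2
  refine h.1 ⟨[Form.falseF], by simpa using hs, .taut ⟨⟨trivial, trivial⟩, trivial⟩ fun v => ?_⟩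
  rw [Form.evalProp_imp]
  exact And.left

theorem and_mem (h : MCS k Δ) {φ ψ : Form Pred Cons} (hφ : φ.isStatic) (hψ : ψ.isStatic) :
    φ.and ψ ∈ Δ ↔ φ ∈ Δ ∧ ψ ∈ Δ := by
  refine ⟨fun h' => ⟨h.mem_of_evalProp [_] (List.forall_mem_singleton.2 h') hφ fun v hv => ?_,
    h.mem_of_evalProp [_] (List.forall_mem_singleton.2 h') hψ fun v hv => ?_⟩,
    fun h' => h.mem_of_evalProp [φ, ψ] (by simp [h']) ⟨hφ, hψ⟩ fun v hv => ?_⟩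
  · exact (List.forall_mem_singleton.1 hv).1
  · exact (List.forall_mem_singleton.1 hv).2
  · simpa using hv

theorem imp_mem (h : MCS k Δ) {φ ψ : Form Pred Cons} (hφ : φ.isStatic) (hψ : ψ.isStatic) :
    φ.imp ψ ∈ Δ ↔ (φ ∈ Δ → ψ ∈ Δ) := by
  rw [Form.imp, h.neg_mem (φ := φ.and ψ.neg) ⟨hφ, hψ⟩, h.and_mem (ψ := ψ.neg) hφ hψ, h.neg_mem hψ]
  tauto

theorem iffF_mem (h : MCS k Δ) {φ ψ : Form Pred Cons} (hφ : φ.isStatic) (hψ : ψ.isStatic) :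
    φ.iffF ψ ∈ Δ ↔ (φ ∈ Δ ↔ ψ ∈ Δ) := by
  rw [Form.iffF, h.and_mem (Form.isStatic_imp.2 ⟨hφ, hψ⟩) (Form.isStatic_imp.2 ⟨hψ, hφ⟩),
    h.imp_mem hφ hψ, h.imp_mem hψ hφ, ← iff_def]

theorem bigAnd_mem (h : MCS k Δ) {l : List (Form Pred Cons)} (hl : ∀ φ ∈ l, φ.isStatic) :
    Form.bigAnd l ∈ Δ ↔ ∀ φ ∈ l, φ ∈ Δ := by
  induction l with
  | nil =>
    simp only [List.not_mem_nil, false_imp_iff, implies_true, iff_true]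
    exact h.mem_of_evalProp [.eq (.var .x) (.var .x)]
      (List.forall_mem_singleton.2 (h.mem_of_prov trivial (.eqRefl _))) trivial
      fun v hv hn => hn (List.forall_mem_singleton.1 hv)
  | cons φ l ih =>
    rw [List.forall_mem_cons] at hl
    rw [Form.bigAnd, h.and_mem hl.1 (Form.isStatic_bigAnd.2 hl.2), ih hl.2, List.forall_mem_cons]

theorem bigOr_mem (h : MCS k Δ) {l : List (Form Pred Cons)} (hl : ∀ φ ∈ l, φ.isStatic)
    (hΔ : Form.bigOr l ∈ Δ) : ∃ φ ∈ l, φ ∈ Δ := by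
  induction l with
  | nil => exact absurd (h.mem_of_prov (Form.isStatic_eq _ _) (.eqRefl _))
              ((h.neg_mem (Form.isStatic_eq _ _)).1 hΔ)
  | cons φ l ih =>
    rw [List.forall_mem_cons] at hl
    have hs := Form.isStatic_bigOr.2 hl.2
    rw [Form.bigOr, Form.or, h.neg_mem (φ := .and φ.neg (Form.bigOr l).neg) ⟨hl.1, hs⟩,
      h.and_mem (φ := φ.neg) (ψ := (Form.bigOr l).neg) hl.1 hs, h.neg_mem hl.1,
      h.neg_mem hs] at hΔ
    rw [List.exists_mem_cons_iff]
    by_cases hφ : φ ∈ Δ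
    · exact .inl hφ
    · exact .inr (ih hl.2 (by tauto))

/-- Provable implications between static formulas can be applied inside `Δ`. -/
theorem mem_of_imp (h : MCS k Δ) {φ ψ : Form Pred Cons} (hp : Prov k (φ.imp ψ))
    (hψ : ψ.isStatic) (hφΔ : φ ∈ Δ) : ψ ∈ Δ :=
  (h.imp_mem (h.2.1 φ hφΔ) hψ).1 (h.mem_of_prov ⟨h.2.1 φ hφΔ, hψ⟩ hp) hφΔ

theorem eq_symm (h : MCS k Δ) {t₁ t₂ : Term Cons} (h₁ : .eq t₁ t₂ ∈ Δ) : .eq t₂ t₁ ∈ Δ :=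
  h.mem_of_imp (.eqSymm _ _) trivial h₁

theorem eq_trans (h : MCS k Δ) {t₁ t₂ t₃ : Term Cons} (h₁ : .eq t₁ t₂ ∈ Δ)
    (h₂ : .eq t₂ t₃ ∈ Δ) : .eq t₁ t₃ ∈ Δ :=
  h.mem_of_imp (.eqTrans _ t₂ _) trivial <|
    (h.and_mem (Form.isStatic_eq _ _) (Form.isStatic_eq _ _)).2 ⟨h₁, h₂⟩

theorem exists_eq_const (h : MCS k Δ) (t : Term Cons) : ∃ c, .eq t (.const c) ∈ Δ := by
  cases t with
  | const c => exact ⟨c, h.mem_of_prov trivial (.eqRefl _)⟩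
  | var z =>
    have hs : ∀ φ ∈ (Finset.univ : Finset Cons).toList.map fun c =>
        (Form.eq (.var z) (.const c) : Form Pred Cons), φ.isStatic := by
      simp [Form.isStatic]
    obtain ⟨φ, hφ, hφΔ⟩ :=
      h.bigOr_mem hs (h.mem_of_prov (Form.isStatic_bigOr.2 hs) (.atSomewhere z))
    obtain ⟨c, -, rfl⟩ := List.mem_map.1 hφ
    exact ⟨c, hφΔ⟩

theorem foldr_replace_mem (h : MCS k Δ) {f : Term Cons → Term Cons}
    (hf : ∀ t, .eq (f t) t ∈ Δ) (S : List (Term Cons)) {α : Form Pred Cons} (hα : α.isBase) :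
    (S.foldr (fun t β => β.replace (f t) t) α).isBase ∧
      (S.foldr (fun t β => β.replace (f t) t) α ∈ Δ ↔ α ∈ Δ) := by
  induction S with
  | nil => exact ⟨hα, Iff.rfl⟩
  | cons t S ih =>
    have hb := Form.isBase_replace (f t) t ih.1
    refine ⟨hb, Iff.trans (Iff.symm ?_) ih.2⟩
    exact (h.iffF_mem ih.1.isStatic hb.isStatic).1 (h.mem_of_imp (.eqSubst _ _ ih.1)
      ⟨⟨ih.1.isStatic, hb.isStatic⟩, hb.isStatic, ih.1.isStatic⟩ (hf t))

/-- A maximally consistent set determines an interpretation of the vocabulary and a situation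
in which exactly its base formulas are true. -/
theorem exists_interp (h : MCS k Δ) :
    ∃ (D : Type) (_ : Finite D) (I : Interp Pred Cons D) (σ : Assign D),
      Function.Surjective I.const ∧ (∀ s, ∃ t, I.rel s t) ∧
      ∀ Sit sim (α : Form Pred Cons), α.isBase → (Sat k I Sit sim σ α ↔ α ∈ Δ) := by
  let S : Setoid Cons :=
    { r := fun c d => (.eq (.const c) (.const d) : Form Pred Cons) ∈ Δ
      iseqv := ⟨fun _ => h.mem_of_prov trivial (.eqRefl _), h.eq_symm, h.eq_trans⟩ }
  let I : Interp Pred Cons (Quotient S) :=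
    { pred := fun P l => .pred P (l.map fun q => .const q.out) ∈ Δ
      rel := fun a b => .rel (.const a.out) (.const b.out) ∈ Δ
      const := Quotient.mk S }
  choose g hg using h.exists_eq_const
  let σ : Assign (Quotient S) := fun z => Quotient.mk S (g (.var z))
  have hval : ∀ t : Term Cons, t.val I σ = Quotient.mk S (g t) := by
    rintro (c | z)
    · exact Quotient.sound (hg (.const c))
    · rfl
  let f : Term Cons → Term Cons := fun t => .const (t.val I σ).out
  have hf : ∀ t, .eq (f t) t ∈ Δ := fun t => by
    refine h.eq_trans ?_ (h.eq_symm (hg t))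
    have : S.r (t.val I σ).out (g t) := Quotient.exact ((Quotient.out_eq _).trans (hval t))
    exact this
  have hff : ∀ t, f (f t) = f t := fun t =>
    congrArg Term.const (congrArg Quotient.out (Quotient.out_eq (t.val I σ)))
  have hsurj : Function.Surjective I.const := Quotient.mk_surjective
  have hrel : ∀ t₁ t₂ : Term Cons, I.rel (t₁.val I σ) (t₂.val I σ) ↔ .rel t₁ t₂ ∈ Δ := by
    intro t₁ t₂
    have h₁ : ∀ (L : List (Term Cons)) (t₁ t₂ : Term Cons),
        L.foldr (fun t β => β.replace (f t) t) (.rel t₁ t₂ : Form Pred Cons) =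
          .rel (L.foldr (fun s u => Term.repl (f s) s u) t₁)
            (L.foldr (fun s u => Term.repl (f s) s u) t₂) := fun L t₁ t₂ => by
      induction L with
      | nil => rfl
      | cons s L ih => simp only [List.foldr_cons, ih, Form.replace]
    rw [← (h.foldr_replace_mem hf [t₁, t₂] (α := .rel t₁ t₂) trivial).2, h₁, foldr_repl hff,
      foldr_repl hff, if_pos (by simp), if_pos (by simp)]
  refine ⟨Quotient S, inferInstance, I, σ, hsurj, fun s => ?_, fun Sit sim α hα => ?_⟩
  · obtain ⟨c, rfl⟩ := hsurj s
    have hs : ∀ φ ∈ (Finset.univ : Finset Cons).toList.map fun t =>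
        (Form.rel (.const c) (.const t) : Form Pred Cons), φ.isStatic := by
      simp [Form.isStatic]
    obtain ⟨φ, hφ, hφΔ⟩ :=
      h.bigOr_mem hs (h.mem_of_prov (Form.isStatic_bigOr.2 hs) (.seriality c))
    obtain ⟨d, -, rfl⟩ := List.mem_map.1 hφ
    exact ⟨_, (hrel (.const c) (.const d)).2 hφΔ⟩
  · induction α with
    | pred P args =>
      have h₁ : ∀ L : List (Term Cons),
          L.foldr (fun t β => β.replace (f t) t) (.pred P args : Form Pred Cons) =
            .pred P (args.map (L.foldr (fun s u => Term.repl (f s) s u))) := fun L => by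
        induction L with
        | nil => simp
        | cons s L ih => simp [ih, Form.replace, Function.comp_def]
      have h₂ : args.map (args.foldr (fun s u => Term.repl (f s) s u)) = args.map f :=
        List.map_congr_left fun t ht => by rw [foldr_repl hff, if_pos ht]
      rw [← (h.foldr_replace_mem hf args (α := .pred P args) trivial).2, h₁, h₂]
      simp only [Sat, I, List.map_map]
      rfl
    | rel t₁ t₂ => exact sat_rel.trans (hrel t₁ t₂)
    | eq t₁ t₂ =>
      rw [sat_eq, hval, hval, Quotient.eq]
      exact ⟨fun h' => h.eq_trans (hg t₁) (h.eq_trans h' (h.eq_symm (hg t₂))),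
        fun h' => h.eq_trans (h.eq_symm (hg t₁)) (h.eq_trans h' (hg t₂))⟩
    | neg φ ih => rw [sat_neg, ih hα, h.neg_mem (φ := φ) (Form.isBase.isStatic hα)]
    | and φ ψ ih₁ ih₂ =>
      rw [sat_and, ih₁ hα.1, ih₂ hα.2, h.and_mem hα.1.isStatic hα.2.isStatic]
    | K | Kt | box => exact hα.elim

section Interp

variable {D : Type} {I : Interp Pred Cons D} {σ : Assign D}

theorem K_mem (h : MCS k Δ)
    (hI : ∀ Sit sim (α : Form Pred Cons), α.isBase → (Sat k I Sit sim σ α ↔ α ∈ Δ))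
    (Sit : Set (Assign D)) (sim : SimRel D) (z : Var) {α : Form Pred Cons} (hα : α.isBase) :
    .K z α ∈ Δ ↔ ∀ c, Form.diaK z (.eq (.var z.other) (.const c)) ∈ Δ →
      Sat k I Sit sim (Function.update σ z.other (I.const c)) α := by
  classical
  let T : Finset Cons :=
    Finset.univ.filter fun c => Form.diaK z (.eq (.var z.other) (.const c)) ∈ Δ
  have hsT : ∀ φ ∈ T.toList.map fun c => α.substC c z.other, φ.isStatic := by
    simpa using fun c _ => (Form.isBase_substC c z.other hα).isStatic
  have hT : (KzEqSet z z.other T : Form Pred Cons) ∈ Δ := by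
    refine (h.bigAnd_mem fun φ hφ => ?_).2 ?_
    · rcases List.mem_append.1 hφ with h | h <;> obtain ⟨c, -, rfl⟩ := List.mem_map.1 h <;>
        trivial
    · simp only [List.forall_mem_append, List.forall_mem_map, Finset.mem_toList,
        Finset.mem_compl, T, Finset.mem_filter, Finset.mem_univ, true_and, imp_self,
        implies_true]
      intro c hc
      rwa [Form.diaK, h.neg_mem (φ := .K z (.neg (.eq _ _))) trivial, not_not] at hc
  have hs := Form.isStatic_bigAnd.2 hsT
  have hg := h.mem_of_imp (.kGround z T hα) ⟨⟨hα, hs⟩, hs, hα⟩ hT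
  rw [h.iffF_mem (Form.isStatic_K.2 hα) hs, h.bigAnd_mem hsT] at hg
  rw [hg, List.forall_mem_map]
  simp only [Finset.mem_toList, T, Finset.mem_filter, Finset.mem_univ, true_and]
  exact forall₂_congr fun c _ => by
    rw [← sat_substC hα, hI _ _ _ (Form.isBase_substC c z.other hα)]

theorem Kt_mem (h : MCS k Δ)
    (hI : ∀ Sit sim (α : Form Pred Cons), α.isBase → (Sat k I Sit sim σ α ↔ α ∈ Δ))
    (z : Var) (t : Term Cons) :
    .Kt z t ∈ Δ ↔ ∀ c, Form.diaK z (.eq (.var z.other) (.const c)) ∈ Δ →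
      t.val I σ = t.val I (Function.update σ z.other (I.const c)) := by
  obtain ⟨e, he⟩ := h.exists_eq_const t
  have hd := h.mem_of_imp (.deRe z t e) ⟨⟨trivial, trivial⟩, trivial, trivial⟩ he
  have hv : t.val I σ = I.const e := sat_eq.1 ((hI ∅ (updSim D) _ (Form.isBase_eq _ _)).2 he)
  rw [(h.iffF_mem (Form.isStatic_Kt _ _) (Form.isStatic_K.2 (Form.isBase_eq _ _))).1 hd,
    h.K_mem hI ∅ (updSim D) z (Form.isBase_eq _ _)]
  simp only [sat_eq, hv]
  exact forall₂_congr fun c _ => eq_comm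

theorem diaK_mem_of_mem (h : MCS k Δ) (z : Var) {α : Form Pred Cons} (hα : α.isBase)
    (hαΔ : α ∈ Δ) : Form.diaK z α ∈ Δ := by
  rw [Form.diaK, h.neg_mem (φ := .K z α.neg) hα]
  exact fun hK => (h.neg_mem hα.isStatic).1
    (h.mem_of_imp (.tAx (α := α.neg) z hα) hα.isStatic hK) hαΔ

end Interp

end MCS

/-- A formula belonging to all maximally consistent sets is provable. -/
theorem Prov.of_forall_MCS {φ : Form Pred Cons} (hφ : φ.isStatic)
    (h : ∀ Δ : Set (Form Pred Cons), MCS k Δ → φ ∈ Δ) : Prov k φ := by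
  by_contra hp
  have hc : consistentS k {φ.neg} := by
    rintro ⟨l, hl, hl'⟩
    refine hp (.of_evalProp [_] (List.forall_mem_singleton.2 ⟨hl', Form.isStatic_imp.2
      ⟨Form.isStatic_bigAnd.2 fun ψ hψ => ?_, trivial⟩⟩) hφ fun v hv hv' => ?_)
    · rw [hl ψ hψ]
      exact hφ
    · by_contra hn
      simp only [List.mem_singleton, forall_eq, Form.evalProp_imp, Form.evalProp_bigAnd hv,
        Form.evalProp_falseF, hv, not_true_eq_false, imp_false] at hv'
      refine hv' fun ψ hψ => ?_
      rw [hl ψ hψ]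
      exact hn
  obtain ⟨Δ, hΔ, hM⟩ := hc.exists_MCS (by rintro _ rfl; exact hφ)
  exact (hM.neg_mem hφ).1 (hΔ rfl) (h Δ hM)

/-- A player considering possible a visible position of the other player does not consider any
other position possible. -/
theorem MCS.eq_of_diaK {Δ : Set (Form Pred Cons)} (h : MCS k Δ) {D : Type}
    {I : Interp Pred Cons D} {σ : Assign D} (hsurj : Function.Surjective I.const)
    (hI : ∀ Sit sim (α : Form Pred Cons), α.isBase → (Sat k I Sit sim σ α ↔ α ∈ Δ))
    {z : Var} {c d : Cons}
    (hc : Form.diaK z (.eq (.var z.other) (.const c)) ∈ Δ)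
    (hd : Form.diaK z (.eq (.var z.other) (.const d)) ∈ Δ)
    (hb : I.const c ∈ Dball I k (σ z)) : I.const c = I.const d := by
  by_contra hne
  let αs : List (Form Pred Cons) :=
    [distForm Pred k (.var z) (.const c), .neg (.eq (.const c) (.const d))]
  let βs : List (Form Pred Cons) :=
    [.eq (.var z.other) (.const c), .eq (.var z.other) (.const d)]
  have hαs : ∀ γ ∈ αs, γ.isBase := by
    simp [αs, Form.isBase_distForm, Form.isBase]
  have hβs : ∀ γ ∈ βs, γ.isBase := by
    simp [βs, Form.isBase]
  have hmem : ∀ Θ : Set (Form Pred Cons), MCS k Θ → (kConj z αs βs ∈ Θ ↔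
      (.K z (distForm Pred k (.var z) (.const c)) ∈ Θ ∧
        .K z (.neg (.eq (.const c) (.const d))) ∈ Θ) ∧
      Form.diaK z (.eq (.var z.other) (.const c)) ∈ Θ ∧
        Form.diaK z (.eq (.var z.other) (.const d)) ∈ Θ) := fun Θ hΘ => by
    rw [kConj, hΘ.bigAnd_mem (Form.isStatic_bigAnd.1 (Form.isStatic_kConj hαs hβs))]
    simp [αs, βs, and_assoc]
  have hp : Prov k ((kConj z αs βs).imp (.neg (.eq (.var z.other) (.const c)))) := by
    have hs := Form.isStatic_kConj (z := z) hαs hβs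
    refine .of_forall_MCS ⟨hs, trivial⟩ fun Θ hΘ => ?_
    rw [hΘ.imp_mem hs (ψ := .neg (.eq _ _)) trivial, hmem Θ hΘ, hΘ.neg_mem (Form.isStatic_eq _ _)]
    rintro ⟨⟨h₁, h₂⟩, -, h₄⟩ h₅
    obtain ⟨D, -, I, σ, hsurj, -, hI⟩ := hΘ.exists_interp
    have hD := Form.isBase_distForm (Pred := Pred) k (.var z) (.const c)
    have hz : σ z.other = I.const c := sat_eq.1 ((hI ∅ (updSim D) _ (Form.isBase_eq _ _)).2 h₅)
    have hsee : distForm Pred k (.var z) (.var z.other) ∈ Θ := by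
      have h₆ := (hI ∅ (updSim D) _ hD).2 (hΘ.mem_of_imp (.tAx z hD) hD.isStatic h₁)
      rw [sat_distForm hsurj] at h₆
      rw [← hI ∅ (updSim D) _ (Form.isBase_distForm _ _ _), sat_distForm hsurj]
      simpa only [Term.val, hz] using h₆
    have hK := hΘ.mem_of_imp (.ksight z _) trivial hsee
    have hzd := (hΘ.Kt_mem hI z _).1 hK d h₄
    simp only [Term.val, Function.update_self, hz] at hzd
    exact sat_neg.1 ((hI ∅ (updSim D) (.neg (.eq _ _)) trivial).2
      (hΘ.mem_of_imp (.tAx z (α := .neg (.eq _ _)) trivial) trivial h₂)) (sat_eq.2 hzd)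
  have hK := h.mem_of_imp
    (.kAdd z αs βs (α := .neg (.eq _ _)) trivial hαs hβs (by simp [αs, βs]) hp) trivial
    ((hmem Δ h).2 ⟨⟨?_, ?_⟩, hc, hd⟩)
  · exact (h.neg_mem (φ := .K z (.neg (.eq _ _))) trivial).1 hc hK
  · refine (h.K_mem hI ∅ (updSim D) z (Form.isBase_distForm _ _ _)).2 fun e _ => ?_
    rw [sat_distForm hsurj]
    simpa only [Term.val, Function.update_of_ne z.ne_other] using hb
  · exact (h.K_mem hI ∅ (updSim D) z (α := .neg (.eq _ _)) trivial).2
      fun e _ => by simpa [Term.val] using hne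

/-- Every maximally consistent set is satisfied in a `k`-sight model. -/
theorem MCS.exists_model {Δ : Set (Form Pred Cons)} (h : MCS k Δ) :
    ∃ (D : Type) (_ : Finite D) (I : Interp Pred Cons D)
      (Sit : Set (Assign D)) (sim : SimRel D),
      IsModel I Sit sim ∧ KSight k I Sit sim ∧
        ∃ σ ∈ Sit, ∀ φ ∈ Δ, Sat k I Sit sim σ φ := by
  obtain ⟨D, hD, I, σ, hsurj, hser, hI⟩ := h.exists_interp
  let C : Var → Set (Assign D) := fun z => {τ | ∃ c,
    Form.diaK z (.eq (.var z.other) (.const c)) ∈ Δ ∧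
      τ = Function.update σ z.other (I.const c)}
  have hσ : ∀ z, σ ∈ C z := fun z => by
    obtain ⟨c, hc⟩ := h.exists_eq_const (.var z.other)
    refine ⟨c, h.diaK_mem_of_mem z trivial hc, ?_⟩
    have : σ z.other = I.const c := sat_eq.1 ((hI ∅ (updSim D) _ (Form.isBase_eq _ _)).2 hc)
    rw [← this, Function.update_eq_self]
  let Sit : Set (Assign D) := ⋃ z, C z
  have hC : ∀ z, C z ⊆ Sit := Set.subset_iUnion C
  let sim : SimRel D := fun z τ τ' => (τ = τ' ∧ τ ∈ Sit) ∨ (τ ∈ C z ∧ τ' ∈ C z)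
  have hM : IsModel I Sit sim := by
    refine ⟨hser, hsurj, ⟨σ, hC .x (hσ .x)⟩, ?_, fun z τ hτ => .inl ⟨rfl, hτ⟩, ?_, ?_⟩
    · rintro z τ τ' (⟨rfl, h⟩ | ⟨h, h'⟩)
      exacts [⟨h, h⟩, ⟨hC z h, hC z h'⟩]
    · rintro z τ τ' (⟨rfl, h⟩ | ⟨h, h'⟩)
      exacts [.inl ⟨rfl, h⟩, .inr ⟨h', h⟩]
    · rintro z τ τ' τ'' (⟨rfl, h⟩ | ⟨h, h'⟩) (⟨rfl, h''⟩ | ⟨h'', h'''⟩)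
      exacts [.inl ⟨rfl, h⟩, .inr ⟨h'', h'''⟩, .inr ⟨h, h'⟩, .inr ⟨h, h'''⟩]
  have hk : KSight k I Sit sim := by
    rintro z τ τ' - - (⟨rfl, -⟩ | ⟨⟨c, hc, rfl⟩, ⟨d, hd, rfl⟩⟩) w hw
    · rfl
    · rcases z.eq_or_eq_other w with rfl | rfl
      · simp only [Function.update_of_ne w.ne_other]
      · simp only [Function.update_self, Function.update_of_ne z.ne_other] at hw ⊢
        exact h.eq_of_diaK hsurj hI hc hd hw
  have hsim : ∀ z (p : Assign D → Prop), (∀ σ' ∈ Sit, sim z σ' σ → p σ') ↔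
      ∀ c, Form.diaK z (.eq (.var z.other) (.const c)) ∈ Δ →
        p (Function.update σ z.other (I.const c)) := by
    refine fun z p => ⟨fun hp c hc => hp _ (hC z ⟨c, hc, rfl⟩) (.inr ⟨⟨c, hc, rfl⟩, hσ z⟩), ?_⟩
    intro hp σ' _ hs
    have : σ' ∈ C z := by
      rcases hs with ⟨rfl, -⟩ | ⟨hs, -⟩
      exacts [hσ z, hs]
    obtain ⟨c, hc, rfl⟩ := this
    exact hp c hc
  have truth : ∀ φ : Form Pred Cons, φ.isStatic → (Sat k I Sit sim σ φ ↔ φ ∈ Δ) := by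
    intro φ hφ
    induction φ with
    | neg φ ih => rw [sat_neg, ih hφ, h.neg_mem (φ := φ) hφ]
    | and φ ψ ih₁ ih₂ => rw [sat_and, ih₁ hφ.1, ih₂ hφ.2, h.and_mem hφ.1 hφ.2]
    | Kt z t => rw [sat_Kt, hsim, h.Kt_mem hI]
    | K z φ => rw [sat_K, hsim, h.K_mem hI Sit sim z hφ]
    | box => exact hφ.elim
    | _ => exact hI _ _ _ trivial
  exact ⟨D, hD, I, Sit, sim, hM, hk, σ, hC .x (hσ .x),
    fun φ hφ => (truth φ (h.2.1 φ hφ)).2 hφ⟩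

theorem consistentS.exists_model {Γ : Set (Form Pred Cons)} (hΓ : ∀ φ ∈ Γ, φ.isStatic)
    (hc : consistentS k Γ) :
    ∃ (D : Type) (_ : Finite D) (I : Interp Pred Cons D)
      (Sit : Set (Assign D)) (sim : SimRel D),
      IsModel I Sit sim ∧ KSight k I Sit sim ∧
        ∃ σ ∈ Sit, ∀ φ ∈ Γ, Sat k I Sit sim σ φ := by
  obtain ⟨Δ, hΓΔ, hΔ⟩ := hc.exists_MCS hΓ
  obtain ⟨D, hD, I, Sit, sim, hM, hk, σ, hσ, hsat⟩ := hΔ.exists_model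
  exact ⟨D, hD, I, Sit, sim, hM, hk, σ, hσ, fun φ hφ => hsat φ (hΓΔ hφ)⟩

end Calculus

end Completeness

/-- **Strong completeness of `ELCR⁻`.** Every consistent set of
`L⁻`-formulas is satisfiable in a `k`-sight model; consequently the static logic
is compact. -/
theorem elcr_minus_complete {Pred Cons : Type} [Fintype Cons] [DecidableEq Cons]
    [Nonempty Cons] (k : ℕ) :
    (∀ Γ : Set (Form Pred Cons), (∀ φ ∈ Γ, φ.isStatic) → consistentS k Γ →
      ∃ (D : Type) (_ : Finite D) (I : Interp Pred Cons D)
        (Sit : Set (Assign D)) (sim : SimRel D),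
        IsModel I Sit sim ∧ KSight k I Sit sim ∧
          ∃ σ ∈ Sit, ∀ φ ∈ Γ, Sat k I Sit sim σ φ) ∧
    (∀ Γ : Set (Form Pred Cons), (∀ φ ∈ Γ, φ.isStatic) →
      (∀ Γ₀ : Finset (Form Pred Cons), ↑Γ₀ ⊆ Γ →
        ∃ (D : Type) (_ : Finite D) (I : Interp Pred Cons D)
          (Sit : Set (Assign D)) (sim : SimRel D),
          IsModel I Sit sim ∧ KSight k I Sit sim ∧
            ∃ σ ∈ Sit, ∀ φ ∈ Γ₀, Sat k I Sit sim σ φ) →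
      ∃ (D : Type) (_ : Finite D) (I : Interp Pred Cons D)
        (Sit : Set (Assign D)) (sim : SimRel D),
        IsModel I Sit sim ∧ KSight k I Sit sim ∧
          ∃ σ ∈ Sit, ∀ φ ∈ Γ, Sat k I Sit sim σ φ) := by
  refine ⟨fun Γ hΓ hc => hc.exists_model hΓ, fun Γ hΓ hfin =>
    consistentS.exists_model hΓ ?_⟩
  rintro ⟨l, hl, hp⟩
  classical
  obtain ⟨D, -, I, Sit, sim, hM, hk, σ, hσ, hsat⟩ :=
    hfin l.toFinset fun φ hφ => hl φ (List.mem_toFinset.1 hφ)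
  exact sat_falseF (sat_imp.1 (hp.sound hM hk hσ)
    (sat_bigAnd.2 fun φ hφ => hsat φ (List.mem_toFinset.2 hφ)))
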